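/- arXiv:2002.00309 — 2 statements merged into one kernel-verified Lean document; each statement's English description precedes it below -/
import Mathlib

section
/- For n ≥ 2 and m ≥ 1, mbt(K_{2n+1} □ C_{2m+1}) = 2n + 3, i.e., one more than the maximum degree 2n + 2 of K_{2n+1} □ C_{2m+1}. -/
open SimpleGraph
open scoped Classical

/-- A matching book embedding of `G` in `k` pages: a linear order (spine) on the
vertices together with a page assignment for the edges such that each page is a
matching (every vertex has degree at most one per page) and edges on the same
page do not cross with respect to the spine order. -/
structure MatchingBookEmbedding {V : Type*} [Fintype V] (G : SimpleGraph V) (k : ℕ) where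
  ord : V ≃ Fin (Fintype.card V)
  page : G.edgeSet → Fin k
  matching : ∀ e f : G.edgeSet, e ≠ f → page e = page f →
    ∀ v : V, v ∈ (e : Sym2 V) → v ∉ (f : Sym2 V)
  noncross : ∀ e f : G.edgeSet, page e = page f →
    ∀ a b c d : V, (e : Sym2 V) = s(a, b) → (f : Sym2 V) = s(c, d) →
      ord a < ord c → ord c < ord b → ord b < ord d → False

/-- The matching book thickness: the minimum number of pages over all matching
book embeddings. -/
noncomputable def mbt {V : Type*} [Fintype V] (G : SimpleGraph V) : ℕ :=
  sInf {k | Nonempty (MatchingBookEmbedding G k)}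

/-- Local position of `x` in copy `j`: copies with odd index are reversed. -/
def lpos (n x j : ℕ) : ℕ := if j % 2 = 0 then x else 2 * n - x

/-- Page of the edge joining a local position of one block to one of another. -/
def pcol (n m j p j' q : ℕ) : ℕ :=
  if j = j' then
    if j = 0 ∨ j = 2 * m then
      if p + q < 2 * n then p + q + 2
      else if p + q = 2 * n then (if j = 0 then 2 * n + 2 else 0)
      else p + q - 2 * n
    else if p + q < 2 * n + 1 then p + q + 1 else p + q - 2 * n
  else if (j = 0 ∧ j' = 2 * m) ∨ (j' = 0 ∧ j = 2 * m) then min p q + 1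
  else if min j j' % 2 = 0 then 0 else 2 * n + 2

/-- Adjacency in local coordinates. -/
def padj (n m j p j' q : ℕ) : Prop :=
  (j = j' ∧ p ≠ q) ∨ ((j' = j + 1 ∨ j = j' + 1) ∧ p + q = 2 * n) ∨
  (((j = 0 ∧ j' = 2 * m) ∨ (j' = 0 ∧ j = 2 * m)) ∧ p = q)

lemma pcol_comm (n m j p j' q : ℕ) : pcol n m j p j' q = pcol n m j' q j p := by
  unfold pcol
  rw [Nat.add_comm p q, min_comm p q, min_comm j j']
  split_ifs <;> omega

lemma pcol_lt (n m j p j' q : ℕ) (hp : p < 2 * n + 1) (hq : q < 2 * n + 1) :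
    pcol n m j p j' q < 2 * n + 3 := by
  unfold pcol
  split_ifs <;> omega

/-- Ordering of blocks followed by local positions. -/
def plt (j p j' q : ℕ) : Prop := j < j' ∨ (j = j' ∧ p < q)

lemma plt_iff (N j p j' q : ℕ) (hp : p < N) (hq : q < N) :
    j * N + p < j' * N + q ↔ plt j p j' q := by
  unfold plt
  rcases lt_trichotomy j j' with h | h | h
  · have : (j + 1) * N ≤ j' * N := Nat.mul_le_mul_right _ h
    rw [Nat.add_mul] at this
    simp only [h, true_or, iff_true]
    omega
  · subst h; omega
  · have : (j' + 1) * N ≤ j * N := Nat.mul_le_mul_right _ h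
    rw [Nat.add_mul] at this
    omega

set_option maxHeartbeats 1000000 in
/-- The possible shapes of an edge, together with its page `c`. -/
lemma pkinds (n m j p j' q c : ℕ) (hm : 1 ≤ m) (h : padj n m j p j' q)
    (hc : pcol n m j p j' q = c) :
    (j = j' ∧ p ≠ q ∧ ((j = 0 ∨ j = 2 * m) ∧ (p + q + 2 = c ∧ c < 2 * n + 2 ∨
        p + q = c + 2 * n ∧ 0 < c ∨ p + q = 2 * n ∧ (j = 0 ∧ c = 2 * n + 2 ∨ j = 2 * m ∧ c = 0)))) ∨
    (j = j' ∧ p ≠ q ∧ j ≠ 0 ∧ j ≠ 2 * m ∧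
      (p + q + 1 = c ∧ c < 2 * n + 2 ∨ p + q = c + 2 * n ∧ 0 < c)) ∨
    (j' = j + 1 ∧ p + q = 2 * n ∧ (j % 2 = 0 ∧ c = 0 ∨ j % 2 = 1 ∧ c = 2 * n + 2)) ∨
    (j = j' + 1 ∧ p + q = 2 * n ∧ (j' % 2 = 0 ∧ c = 0 ∨ j' % 2 = 1 ∧ c = 2 * n + 2)) ∨
    (j = 0 ∧ j' = 2 * m ∧ p = q ∧ c = p + 1) ∨
    (j' = 0 ∧ j = 2 * m ∧ p = q ∧ c = p + 1) := by
  unfold padj at h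
  unfold pcol at hc
  rcases h with ⟨rfl, h⟩ | ⟨h | h, h'⟩ | ⟨⟨h, h''⟩ | ⟨h, h''⟩, h'⟩
  · rw [if_pos rfl] at hc
    by_cases hj : j = 0 ∨ j = 2 * m
    · rw [if_pos hj] at hc
      left
      refine ⟨rfl, h, hj, ?_⟩
      split_ifs at hc <;> omega
    · rw [if_neg hj] at hc
      right; left
      refine ⟨rfl, h, by omega, by omega, ?_⟩
      split_ifs at hc <;> omega
  · rw [if_neg (by omega), if_neg (by omega)] at hc
    right; right; left
    refine ⟨h, h', ?_⟩
    split_ifs at hc <;> omega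
  · rw [if_neg (by omega), if_neg (by omega)] at hc
    right; right; right; left
    refine ⟨h, h', ?_⟩
    split_ifs at hc <;> omega
  · rw [if_neg (by omega), if_pos (by omega)] at hc
    right; right; right; right; left
    omega
  · rw [if_neg (by omega), if_pos (by omega)] at hc
    right; right; right; right; right
    omega

set_option maxHeartbeats 4000000 in
lemma pmatch (n m j p j1 q1 j2 q2 : ℕ) (hm : 1 ≤ m) (hj : j < 2 * m + 1) (hj1 : j1 < 2 * m + 1)
    (hj2 : j2 < 2 * m + 1) (hp : p < 2 * n + 1) (hq1 : q1 < 2 * n + 1) (hq2 : q2 < 2 * n + 1)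
    (h1 : padj n m j p j1 q1) (h2 : padj n m j p j2 q2)
    (h : pcol n m j p j1 q1 = pcol n m j p j2 q2) : j1 = j2 ∧ q1 = q2 := by
  have k1 := pkinds _ _ _ _ _ _ _ hm h1 h
  have k2 := pkinds _ _ _ _ _ _ _ hm h2 rfl
  clear h h1 h2
  generalize pcol n m j p j2 q2 = c at k1 k2
  rcases k1 with k1 | k1 | k1 | k1 | k1 | k1 <;>
  rcases k2 with k2 | k2 | k2 | k2 | k2 | k2 <;> omega

set_option maxHeartbeats 4000000 in
lemma pcross (n m j1 p1 j2 p2 j3 p3 j4 p4 : ℕ) (hm : 1 ≤ m)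
    (hj1 : j1 < 2 * m + 1) (hj2 : j2 < 2 * m + 1) (hj3 : j3 < 2 * m + 1) (hj4 : j4 < 2 * m + 1)
    (hp1 : p1 < 2 * n + 1) (hp2 : p2 < 2 * n + 1) (hp3 : p3 < 2 * n + 1) (hp4 : p4 < 2 * n + 1)
    (h1 : padj n m j1 p1 j3 p3) (h2 : padj n m j2 p2 j4 p4)
    (h : pcol n m j1 p1 j3 p3 = pcol n m j2 p2 j4 p4)
    (l1 : plt j1 p1 j2 p2) (l2 : plt j2 p2 j3 p3) (l3 : plt j3 p3 j4 p4) : False := by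
  have k1 := pkinds _ _ _ _ _ _ _ hm h1 h
  have k2 := pkinds _ _ _ _ _ _ _ hm h2 rfl
  clear h h1 h2
  generalize pcol n m j2 p2 j4 p4 = c at k1 k2
  unfold plt at l1 l2 l3
  rcases k1 with k1 | k1 | k1 | k1 | k1 | k1 <;>
  rcases k2 with k2 | k2 | k2 | k2 | k2 | k2 <;> omega

lemma cyc_adj (m : ℕ) (hm : 1 ≤ m) (u v : Fin (2 * m + 1)) (h : (cycleGraph (2 * m + 1)).Adj u v) :
    (v.val = u.val + 1 ∨ u.val = v.val + 1) ∨
    ((u.val = 0 ∧ v.val = 2 * m) ∨ (v.val = 0 ∧ u.val = 2 * m)) := by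
  rw [cycleGraph_adj'] at h
  have hu := u.isLt
  have hv := v.isLt
  rcases le_total u v with huv | huv
  all_goals
    have huv' := huv
    rw [Fin.le_def] at huv'
    rcases h with h | h <;> rw [Fin.sub_def] at h <;> simp only at h
  all_goals
    first
    | (rw [Nat.mod_eq_of_lt (by omega)] at h; omega)
    | (rw [Nat.mod_eq_sub_mod (by omega), Nat.mod_eq_of_lt (by omega)] at h; omega)
    | (by_cases hh : u.val = v.val
       · simp [hh] at h
       · first
         | (rw [Nat.mod_eq_of_lt (by omega)] at h; omega)
         | (rw [Nat.mod_eq_sub_mod (by omega), Nat.mod_eq_of_lt (by omega)] at h; omega))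

section construction

variable (n m : ℕ)

/-- The graph under consideration. -/
abbrev KC : SimpleGraph (Fin (2 * n + 1) × Fin (2 * m + 1)) :=
  (⊤ : SimpleGraph (Fin (2 * n + 1))) □ cycleGraph (2 * m + 1)

/-- Local position of a vertex. -/
def vp (v : Fin (2 * n + 1) × Fin (2 * m + 1)) : ℕ := lpos n v.1.val v.2.val

lemma vp_lt (v : Fin (2 * n + 1) × Fin (2 * m + 1)) : vp n m v < 2 * n + 1 := by
  have := v.1.isLt
  unfold vp lpos
  split_ifs <;> omega

lemma v_ext (v w : Fin (2 * n + 1) × Fin (2 * m + 1)) (h : v.2.val = w.2.val)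
    (h' : vp n m v = vp n m w) : v = w := by
  have h1 := v.1.isLt
  have h2 := w.1.isLt
  unfold vp lpos at h'
  rw [h] at h'
  refine Prod.ext (Fin.ext ?_) (Fin.ext h)
  split_ifs at h' <;> omega

lemma KC_padj (hm : 1 ≤ m) (v w : Fin (2 * n + 1) × Fin (2 * m + 1)) (h : (KC n m).Adj v w) :
    padj n m v.2.val (vp n m v) w.2.val (vp n m w) := by
  have h1 := v.1.isLt
  have h2 := w.1.isLt
  rw [boxProd_adj] at h
  unfold padj
  rcases h with ⟨h, h'⟩ | ⟨h, h'⟩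
  · left
    refine ⟨congrArg _ h', fun h3 => ?_⟩
    have := v_ext n m v w (congrArg _ h') h3
    rw [this] at h
    exact h.ne rfl
  · right
    unfold vp lpos
    rw [← h']
    rcases cyc_adj m hm _ _ h with h | h
    · left; refine ⟨h, ?_⟩
      split_ifs <;> omega
    · right; refine ⟨h, ?_⟩
      split_ifs <;> omega

/-- Global position. -/
def gpos (v : Fin (2 * n + 1) × Fin (2 * m + 1)) : ℕ := v.2.val * (2 * n + 1) + vp n m v

lemma gpos_lt (v w : Fin (2 * n + 1) × Fin (2 * m + 1)) :
    gpos n m v < gpos n m w ↔ plt v.2.val (vp n m v) w.2.val (vp n m w) :=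
  plt_iff _ _ _ _ _ (vp_lt n m v) (vp_lt n m w)

lemma gpos_bound (v : Fin (2 * n + 1) × Fin (2 * m + 1)) :
    gpos n m v < Fintype.card (Fin (2 * n + 1) × Fin (2 * m + 1)) := by
  have h1 := vp_lt n m v
  have h2 : (v.2.val + 1) * (2 * n + 1) ≤ (2 * m + 1) * (2 * n + 1) :=
    Nat.mul_le_mul_right _ v.2.isLt
  rw [Nat.add_mul v.2.val] at h2
  simp only [Fintype.card_prod, Fintype.card_fin]
  rw [Nat.mul_comm (2 * n + 1)]
  unfold gpos
  omega

lemma gpos_inj : Function.Injective (gpos n m) := by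
  intro v w h
  have h1 := gpos_lt n m v w
  have h2 := gpos_lt n m w v
  unfold plt at h1 h2
  apply v_ext n m v w <;> omega

/-- The spine order. -/
noncomputable def gord : (Fin (2 * n + 1) × Fin (2 * m + 1)) ≃
    Fin (Fintype.card (Fin (2 * n + 1) × Fin (2 * m + 1))) :=
  Equiv.ofBijective (fun v => ⟨gpos n m v, gpos_bound n m v⟩) (by
    rw [Fintype.bijective_iff_injective_and_card]
    refine ⟨fun v w h => gpos_inj n m (by simpa using h), by simp⟩)

/-- Page of a pair of vertices. -/
def vcol (v w : Fin (2 * n + 1) × Fin (2 * m + 1)) : Fin (2 * n + 3) :=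
  ⟨pcol n m v.2.val (vp n m v) w.2.val (vp n m w),
    pcol_lt _ _ _ _ _ _ (vp_lt n m v) (vp_lt n m w)⟩

/-- The same on unordered pairs. -/
def scol : Sym2 (Fin (2 * n + 1) × Fin (2 * m + 1)) → Fin (2 * n + 3) :=
  Sym2.lift ⟨vcol n m, fun v w => Fin.ext (pcol_comm _ _ _ _ _ _)⟩

/-- The embedding in `2 n + 3` pages. -/
noncomputable def theEmbedding (hm : 1 ≤ m) : MatchingBookEmbedding (KC n m) (2 * n + 3) where
  ord := gord n m
  page e := scol n m e.1
  matching := by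
    rintro ⟨e, he⟩ ⟨f, hf⟩ hne hpage v hv hv'
    obtain ⟨w, rfl⟩ := Sym2.mem_iff_exists.1 hv
    obtain ⟨w', rfl⟩ := Sym2.mem_iff_exists.1 hv'
    apply hne
    have hc : pcol n m v.2.val (vp n m v) w.2.val (vp n m w)
      = pcol n m v.2.val (vp n m v) w'.2.val (vp n m w') := congrArg Fin.val hpage
    have := pmatch n m _ _ _ _ _ _ hm v.2.isLt w.2.isLt w'.2.isLt (vp_lt n m v) (vp_lt n m w)
      (vp_lt n m w') (KC_padj n m hm _ _ he) (KC_padj n m hm _ _ hf) hc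
    have hw := v_ext n m w w' this.1 this.2
    subst hw
    rfl
  noncross := by
    rintro ⟨e, he⟩ ⟨f, hf⟩ hpage a b c d hab hcd h1 h2 h3
    simp only at hab hcd
    subst hab hcd
    have hc : pcol n m a.2.val (vp n m a) b.2.val (vp n m b)
      = pcol n m c.2.val (vp n m c) d.2.val (vp n m d) := congrArg Fin.val hpage
    exact pcross n m _ _ _ _ _ _ _ _ hm a.2.isLt c.2.isLt b.2.isLt d.2.isLt
      (vp_lt n m a) (vp_lt n m c) (vp_lt n m b) (vp_lt n m d)
      (KC_padj n m hm _ _ he) (KC_padj n m hm _ _ hf) hc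
      ((gpos_lt n m _ _).1 h1) ((gpos_lt n m _ _).1 h2) ((gpos_lt n m _ _).1 h3)

lemma cyc_degree (N : ℕ) (hN : 3 ≤ N) (v : Fin N) [Fintype ((cycleGraph N).neighborSet v)] :
    (cycleGraph N).degree v = 2 := by
  obtain ⟨k, rfl⟩ : ∃ k, N = k + 3 := ⟨N - 3, by omega⟩
  have := @cycleGraph_degree_three_le k v
  convert this

lemma KC_degree (hm : 1 ≤ m) (v : Fin (2 * n + 1) × Fin (2 * m + 1)) :
    (KC n m).degree v = 2 * n + 2 := by
  obtain ⟨k, rfl⟩ : ∃ k, m = k + 1 := ⟨m - 1, by omega⟩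
  have h2 : (cycleGraph (2 * (k + 1) + 1)).degree v.2 = 2 := by
    exact cyc_degree _ (by omega) _
  have h1 : (⊤ : SimpleGraph (Fin (2 * n + 1))).degree v.1 = 2 * n := by
    simp
  have := degree_boxProd (G := (⊤ : SimpleGraph (Fin (2 * n + 1))))
    (H := cycleGraph (2 * (k + 1) + 1)) v
  rw [h1, h2] at this
  convert this

/-- A graph with an odd number of vertices, all of degree `d`, needs more than `d` pages. -/
lemma lower {V : Type*} [Fintype V] (G : SimpleGraph V) (d k : ℕ) (hd : 0 < d)
    (hreg : ∀ v, G.degree v = d) (hodd : Odd (Fintype.card V))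
    (E : MatchingBookEmbedding G k) : d + 1 ≤ k := by
  by_contra hk
  have hinj : ∀ v : V, Function.Injective
      (fun w : G.neighborSet v => E.page ⟨s(v, w.1), w.2⟩) := by
    intro v w w' h
    by_contra hne
    refine E.matching ⟨s(v, w.1), w.2⟩ ⟨s(v, w'.1), w'.2⟩ ?_ h v (by simp) (by simp)
    intro h'
    have h'' : s(v, w.1) = s(v, w'.1) := congrArg Subtype.val h'
    exact hne (Subtype.ext (Sym2.congr_right.1 h''))
  have hcard : ∀ v : V, Fintype.card (G.neighborSet v) = d := by
    intro v
    rw [card_neighborSet_eq_degree, hreg]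
  have hV : 0 < Fintype.card V := hodd.pos
  obtain ⟨v0⟩ := Fintype.card_pos_iff.1 hV
  have hkd : k = d := by
    have := Fintype.card_le_of_injective _ (hinj v0)
    rw [hcard, Fintype.card_fin] at this
    omega
  subst hkd
  have hsurj : ∀ v : V, ∃ w, ∃ h : G.Adj v w, E.page ⟨s(v, w), h⟩ = ⟨0, hd⟩ := by
    intro v
    have hb := (Fintype.bijective_iff_injective_and_card _).2
      ⟨hinj v, by rw [hcard, Fintype.card_fin]⟩
    obtain ⟨w, hw⟩ := hb.2 ⟨0, hd⟩
    exact ⟨w.1, w.2, hw⟩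
  choose g hg hpage using hsurj
  have hinv : ∀ v, g (g v) = v := by
    intro v
    have h1 : E.page ⟨s(g v, v), (hg v).symm⟩ = ⟨0, hd⟩ := by
      rw [← hpage v]
      congr 2
      exact Sym2.eq_swap
    have := @hinj (g v) ⟨g (g v), hg (g v)⟩ ⟨v, (hg v).symm⟩ ((hpage (g v)).trans h1.symm)
    exact congrArg Subtype.val this
  have heven : Even (Fintype.card V) := by
    have h2 : ∑ _v : V, (1 : ZMod 2) = 0 :=
      Finset.sum_involution (fun v _ => g v) (fun _ _ => by decide)
        (fun v _ _ h => (hg v).ne h.symm) (fun _ _ => Finset.mem_univ _) (fun v _ => hinv v)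
    rw [Finset.sum_const, nsmul_eq_mul, mul_one, Finset.card_univ] at h2
    exact (ZMod.natCast_eq_zero_iff_even).1 h2
  exact (Nat.not_even_iff_odd.2 hodd) heven

end construction

/-- For `n ≥ 2`, `m ≥ 1`, `mbt (K_{2n+1} □ C_{2m+1}) = 2n + 3`, one more than
the maximum degree `2n + 2`. -/
theorem stmt_8 (n m : ℕ) (hn : 2 ≤ n) (hm : 1 ≤ m) :
    mbt ((⊤ : SimpleGraph (Fin (2 * n + 1))) □ cycleGraph (2 * m + 1)) = 2 * n + 3 ∧
    ((⊤ : SimpleGraph (Fin (2 * n + 1))) □ cycleGraph (2 * m + 1)).maxDegree = 2 * n + 2 := by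
  have hdeg := KC_degree n m hm
  refine ⟨le_antisymm (Nat.sInf_le ⟨theEmbedding n m hm⟩)
    (le_csInf ⟨_, ⟨theEmbedding n m hm⟩⟩ ?_), ?_⟩
  · rintro k ⟨E⟩
    refine lower _ (2 * n + 2) k (by omega) (fun v => ?_) ?_ E
    · convert hdeg v
    · simp only [Fintype.card_prod, Fintype.card_fin]
      exact Odd.mul ⟨n, rfl⟩ ⟨m, rfl⟩
  · apply le_antisymm
    · apply maxDegree_le_of_forall_degree_le
      intro v
      exact le_of_eq (by convert hdeg v)
    · have h := degree_le_maxDegree (KC n m) (0, 0)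
      have h' := hdeg (0, 0)
      refine le_trans (le_of_eq ?_) (h.trans (le_of_eq ?_))
      · rw [← h']
        congr!
      · congr!
end

section
/- For n ≥ 2 and m ≥ 1, mbt(K_{2n} □ C_{2m+1}) = 2n + 2, i.e., one more than the maximum degree 2n + 1 of K_{2n} □ C_{2m+1}. -/
open SimpleGraph
open scoped Classical

def redC (N x : ℕ) : ℕ := if x < N then x else x - N

def colP (n m i s j t : ℕ) : ℕ :=
  if s = t then
    if s = 0 then (if redC (2*n+1) (i+j+1) = 2*n then 2*n+1 else redC (2*n+1) (i+j+1))
    else if s = 2*m then redC (2*n+1) (i+j+1)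
    else redC (2*n) (i+j)
  else if s + t = 2*m ∧ (s = 0 ∨ t = 0) then min i j
  else 2*n + (min s t) % 2

def adjP (m i s j t : ℕ) : Prop :=
  (s = t ∧ i ≠ j) ∨ (i = j ∧ (s + 1 = t ∨ t + 1 = s ∨ (s = 0 ∧ t = 2*m) ∨ (t = 0 ∧ s = 2*m)))

def ltP (i s j t : ℕ) : Prop :=
  s < t ∨ (s = t ∧ ((s % 2 = 0 ∧ i < j) ∨ (s % 2 = 1 ∧ j < i)))

theorem colP_symm (n m i s j t : ℕ) : colP n m i s j t = colP n m j t i s := by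
  unfold colP redC
  rw [min_comm i j, min_comm s t, add_comm i j, add_comm s t]
  split_ifs <;> omega

theorem colP_lt (n m i s j t : ℕ) (hi : i < 2*n) (hj : j < 2*n) :
    colP n m i s j t < 2*n+2 := by
  unfold colP redC
  split_ifs <;> omega

set_option maxHeartbeats 4000000 in
theorem colP_matching (n m i s j t k u : ℕ) (hn : 2 ≤ n) (hm : 1 ≤ m) (hi : i < 2*n)
    (hj : j < 2*n) (hk : k < 2*n) (hs : s ≤ 2*m) (ht : t ≤ 2*m) (hu : u ≤ 2*m)
    (h1 : adjP m i s j t) (h2 : adjP m i s k u)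
    (h : colP n m i s j t = colP n m i s k u) : j = k ∧ t = u := by
  unfold adjP at h1 h2
  unfold colP redC at h
  rcases h1 with ⟨h1, h1'⟩ | ⟨h1, h1' | h1' | ⟨h1', h1''⟩ | ⟨h1', h1''⟩⟩ <;>
  rcases h2 with ⟨h2, h2'⟩ | ⟨h2, h2' | h2' | ⟨h2', h2''⟩ | ⟨h2', h2''⟩⟩ <;>
  (split_ifs at h <;> omega)

set_option maxHeartbeats 4000000 in
theorem colP_noncross (n m i s j t k u l v : ℕ) (hn : 2 ≤ n) (hm : 1 ≤ m) (hi : i < 2*n)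
    (hj : j < 2*n) (hk : k < 2*n) (hl : l < 2*n)
    (hs : s ≤ 2*m) (ht : t ≤ 2*m) (hu : u ≤ 2*m) (hv : v ≤ 2*m)
    (h1 : adjP m i s j t) (h2 : adjP m k u l v)
    (h : colP n m i s j t = colP n m k u l v)
    (a : ltP i s k u) (b : ltP k u j t) (c : ltP j t l v) : False := by
  unfold adjP at h1 h2
  unfold ltP at a b c
  unfold colP redC at h
  rcases h1 with ⟨h1, h1'⟩ | ⟨h1, h1' | h1' | ⟨h1', h1''⟩ | ⟨h1', h1''⟩⟩ <;>
  rcases h2 with ⟨h2, h2'⟩ | ⟨h2, h2' | h2' | ⟨h2', h2''⟩ | ⟨h2', h2''⟩⟩ <;>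
  first
  | (exfalso; clear h; omega)
  | (split_ifs at h <;> omega)

theorem adjP_of_adj {n m : ℕ} {x y : Fin (2*n) × Fin (2*m+1)}
    (h : ((⊤ : SimpleGraph (Fin (2 * n))) □ cycleGraph (2 * m + 1)).Adj x y) :
    adjP m x.1 x.2 y.1 y.2 := by
  obtain ⟨i, s⟩ := x
  obtain ⟨j, t⟩ := y
  rw [boxProd_adj] at h
  unfold adjP
  rcases h with ⟨h, h'⟩ | ⟨h, h'⟩
  · left
    simp only at h h'
    subst h'
    refine ⟨rfl, ?_⟩
    intro hij
    exact (SimpleGraph.top_adj _ _).1 h (Fin.ext hij)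
  · right
    simp only at h h'
    subst h'
    refine ⟨rfl, ?_⟩
    have hs := s.2
    have ht := t.2
    rw [cycleGraph_adj'] at h
    simp only [Fin.sub_def] at h
    rcases h with h | h
    · rcases le_or_gt t.val s.val with hle | hlt
      · rw [show 2*m+1 - t.val + s.val = (s.val - t.val) + (2*m+1) by omega,
          Nat.add_mod_right, Nat.mod_eq_of_lt (by omega)] at h
        simp only; omega
      · rw [Nat.mod_eq_of_lt (by omega)] at h
        simp only; omega
    · rcases le_or_gt s.val t.val with hle | hlt
      · rw [show 2*m+1 - s.val + t.val = (t.val - s.val) + (2*m+1) by omega,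
          Nat.add_mod_right, Nat.mod_eq_of_lt (by omega)] at h
        simp only; omega
      · rw [Nat.mod_eq_of_lt (by omega)] at h
        simp only; omega

def posP (n i s : ℕ) : ℕ := 2*n*s + (if s % 2 = 0 then i else 2*n-1-i)

theorem ltP_of_posP {n i s j t : ℕ} (hi : i < 2*n) (hj : j < 2*n)
    (h : posP n i s < posP n j t) : ltP i s j t := by
  unfold posP at h
  unfold ltP
  rcases lt_trichotomy s t with h1 | h1 | h1
  · exact Or.inl h1
  · subst h1
    right
    refine ⟨rfl, ?_⟩
    split_ifs at h <;> omega
  · exfalso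
    have : 2*n*(t+1) ≤ 2*n*s := Nat.mul_le_mul_left _ h1
    rw [mul_add] at this
    split_ifs at h <;> omega

theorem posP_inj {n i s j t : ℕ} (hi : i < 2*n) (hj : j < 2*n)
    (h : posP n i s = posP n j t) : i = j ∧ s = t := by
  unfold posP at h
  rcases lt_trichotomy s t with h1 | h1 | h1
  · exfalso
    have : 2*n*(s+1) ≤ 2*n*t := Nat.mul_le_mul_left _ h1
    rw [mul_add] at this
    split_ifs at h <;> omega
  · subst h1
    refine ⟨?_, rfl⟩
    split_ifs at h <;> omega
  · exfalso
    have : 2*n*(t+1) ≤ 2*n*s := Nat.mul_le_mul_left _ h1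
    rw [mul_add] at this
    split_ifs at h <;> omega

theorem posP_lt {n m i s : ℕ} (hi : i < 2*n) (hs : s < 2*m+1) :
    posP n i s < 2*n*(2*m+1) := by
  unfold posP
  have : 2*n*(s+1) ≤ 2*n*(2*m+1) := Nat.mul_le_mul_left _ hs
  rw [mul_add] at this
  split_ifs <;> omega

theorem exists_ordP (n m : ℕ) :
    ∃ ord : (Fin (2*n) × Fin (2*m+1)) ≃ Fin (Fintype.card (Fin (2*n) × Fin (2*m+1))),
      ∀ x, (ord x).val = posP n x.1 x.2 := by
  have hc : Fintype.card (Fin (2*n) × Fin (2*m+1)) = 2*n*(2*m+1) := by simp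
  let f : (Fin (2*n) × Fin (2*m+1)) → Fin (Fintype.card (Fin (2*n) × Fin (2*m+1))) :=
    fun x => ⟨posP n x.1 x.2, by rw [hc]; exact posP_lt x.1.2 x.2.2⟩
  have hf : Function.Injective f := by
    intro x y h
    have h' : posP n x.1 x.2 = posP n y.1 y.2 := congrArg Fin.val h
    obtain ⟨h1, h2⟩ := posP_inj x.1.2 y.1.2 h'
    exact Prod.ext (Fin.ext h1) (Fin.ext h2)
  refine ⟨Equiv.ofBijective f ((Fintype.bijective_iff_injective_and_card f).2 ⟨hf, by simp⟩), ?_⟩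
  intro x
  rfl

def pageP (n m : ℕ) : Sym2 (Fin (2*n) × Fin (2*m+1)) → Fin (2*n+2) :=
  Sym2.lift ⟨fun x y => ⟨colP n m x.1 x.2 y.1 y.2, colP_lt n m _ _ _ _ x.1.2 y.1.2⟩,
    fun x y => Fin.ext (colP_symm n m _ _ _ _)⟩

theorem pageP_mk (n m : ℕ) (x y : Fin (2*n) × Fin (2*m+1)) :
    (pageP n m s(x, y)).val = colP n m x.1 x.2 y.1 y.2 := rfl

theorem embed_upper (n m : ℕ) (hn : 2 ≤ n) (hm : 1 ≤ m) :
    Nonempty (MatchingBookEmbedding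
      ((⊤ : SimpleGraph (Fin (2 * n))) □ cycleGraph (2 * m + 1)) (2*n+2)) := by
  obtain ⟨ord, hord⟩ := exists_ordP n m
  refine ⟨⟨ord, fun e => pageP n m e.1, ?_, ?_⟩⟩
  · rintro ⟨e, he⟩ ⟨f, hf⟩ hne hp v hve hvf
    simp only at hp hve hvf
    obtain ⟨a, rfl⟩ := Sym2.mem_iff_exists.1 hve
    obtain ⟨b, rfl⟩ := Sym2.mem_iff_exists.1 hvf
    have h1 := adjP_of_adj ((SimpleGraph.mem_edgeSet _).1 he)
    have h2 := adjP_of_adj ((SimpleGraph.mem_edgeSet _).1 hf)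
    have h3 := congrArg Fin.val hp
    rw [pageP_mk, pageP_mk] at h3
    obtain ⟨h4, h5⟩ := colP_matching n m _ _ _ _ _ _ hn hm v.1.2 a.1.2 b.1.2
      (Nat.lt_succ_iff.1 v.2.2) (Nat.lt_succ_iff.1 a.2.2) (Nat.lt_succ_iff.1 b.2.2) h1 h2 h3
    apply hne
    have : a = b := Prod.ext (Fin.ext h4) (Fin.ext h5)
    subst this
    rfl
  · rintro ⟨e, he⟩ ⟨f, hf⟩ hp a b c d hab hcd h1 h2 h3
    simp only at hp hab hcd
    subst hab hcd
    have g1 := adjP_of_adj ((SimpleGraph.mem_edgeSet _).1 he)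
    have g2 := adjP_of_adj ((SimpleGraph.mem_edgeSet _).1 hf)
    have g3 := congrArg Fin.val hp
    rw [pageP_mk, pageP_mk] at g3
    rw [Fin.lt_def, hord, hord] at h1 h2 h3
    exact colP_noncross n m _ _ _ _ _ _ _ _ hn hm a.1.2 b.1.2 c.1.2 d.1.2
      (Nat.lt_succ_iff.1 a.2.2) (Nat.lt_succ_iff.1 b.2.2)
      (Nat.lt_succ_iff.1 c.2.2) (Nat.lt_succ_iff.1 d.2.2) g1 g2 g3
      (ltP_of_posP a.1.2 c.1.2 h1) (ltP_of_posP c.1.2 b.1.2 h2) (ltP_of_posP b.1.2 d.1.2 h3)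

theorem degP {V : Type*} (G : SimpleGraph V) (v : V) (i₁ i₂ : Fintype (G.neighborSet v)) :
    @SimpleGraph.degree V G v i₁ = @SimpleGraph.degree V G v i₂ := by
  rw [Subsingleton.elim i₁ i₂]

theorem regularP (n m : ℕ) (hn : 2 ≤ n) (hm : 1 ≤ m) :
    ((⊤ : SimpleGraph (Fin (2 * n))) □ cycleGraph (2 * m + 1)).IsRegularOfDegree (2*n+1) := by
  intro x
  obtain ⟨k, rfl⟩ : ∃ k, m = k + 1 := ⟨m - 1, by omega⟩
  have h1 : (⊤ : SimpleGraph (Fin (2 * n))).degree x.1 = 2*n-1 := by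
    have := complete_graph_degree x.1
    rw [Fintype.card_fin] at this
    convert this
  have h2 : (cycleGraph (2 * (k+1) + 1)).degree x.2 = 2 := by
    have := cycleGraph_degree_three_le (n := 2*k) (v := x.2)
    exact (degP (cycleGraph (2 * (k+1) + 1)) x.2 _ _).trans this
  have h3 := degree_boxProd (G := (⊤ : SimpleGraph (Fin (2 * n))))
    (H := cycleGraph (2 * (k+1) + 1)) x
  rw [h1, h2] at h3
  have h4 : 2*n-1+2 = 2*n+1 := by omega
  rw [h4] at h3
  convert h3

/-- In a regular graph with as many pages as the degree, ends of an edge have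
positions of different parity. -/
theorem parityP {V : Type*} [Fintype V] (G : SimpleGraph V) (k : ℕ)
    (E : MatchingBookEmbedding G k) (hk : ∀ v, k ≤ G.degree v) (a b : V) (hab : G.Adj a b) :
    (E.ord a).val % 2 ≠ (E.ord b).val % 2 := by
  -- every page is hit at every vertex
  have key : ∀ (p : Fin k) (v : V), ∃ w, ∃ h : G.Adj v w, E.page ⟨s(v, w), h⟩ = p := by
    intro p v
    let f : G.neighborFinset v → Fin k := fun w =>
      E.page ⟨s(v, w.1), (G.mem_neighborFinset v w.1).1 w.2⟩
    have hf : Function.Injective f := by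
      intro w w' h
      by_contra hne
      refine E.matching _ _ ?_ h v (Sym2.mem_mk_left _ _) (Sym2.mem_mk_left _ _)
      intro h'
      have h'' : s(v, w.1) = s(v, w'.1) := congrArg Subtype.val h'
      exact hne (Subtype.ext (Sym2.congr_right.1 h''))
    have hc : Fintype.card (G.neighborFinset v) = G.degree v := by
      rw [Fintype.card_coe, SimpleGraph.card_neighborFinset_eq_degree]
    have hle := Fintype.card_le_of_injective f hf
    have hb : Function.Bijective f := by
      rw [Fintype.bijective_iff_injective_and_card]
      refine ⟨hf, le_antisymm hle ?_⟩
      rw [hc, Fintype.card_fin]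
      exact hk v
    obtain ⟨w, hw⟩ := hb.2 p
    exact ⟨w.1, (G.mem_neighborFinset v w.1).1 w.2, hw⟩
  wlog hlt : E.ord a < E.ord b generalizing a b
  · have hne : E.ord a ≠ E.ord b := fun h => hab.ne (E.ord.injective h)
    exact (this b a hab.symm (lt_of_le_of_ne (not_lt.1 hlt) hne.symm)).symm
  set p := E.page ⟨s(a, b), hab⟩ with hp
  choose σ hσ hσp using key p
  have uniq : ∀ v w (h : G.Adj v w), E.page ⟨s(v, w), h⟩ = p → w = σ v := by
    intro v w h hw
    by_contra hne
    refine E.matching ⟨s(v, w), h⟩ ⟨s(v, σ v), hσ v⟩ ?_ (hw.trans (hσp v).symm) v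
      (Sym2.mem_mk_left _ _) (Sym2.mem_mk_left _ _)
    intro h'
    have h'' : s(v, w) = s(v, σ v) := congrArg Subtype.val h'
    exact hne (Sym2.congr_right.1 h'')
  have swap : ∀ v w (h : G.Adj v w), E.page ⟨s(w, v), h.symm⟩ = E.page ⟨s(v, w), h⟩ := by
    intro v w h
    congr 1
    exact Subtype.ext Sym2.eq_swap
  have inv : ∀ v, σ (σ v) = v := by
    intro v
    exact (uniq (σ v) v (hσ v).symm ((swap v (σ v) (hσ v)).trans (hσp v))).symm
  have hσa : σ a = b := (uniq a b hab rfl).symm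
  have hσb : σ b = a := by rw [← hσa, inv]
  let S : Finset V := Finset.univ.filter fun v => E.ord a < E.ord v ∧ E.ord v < E.ord b
  have hS : S.card = (E.ord b).val - (E.ord a).val - 1 := by
    rw [← Fin.card_Ioo]
    apply Finset.card_bij (fun v _ => E.ord v)
    · intro v hv
      simpa [S] using hv
    · intro v _ w _ h
      exact E.ord.injective h
    · intro x hx
      refine ⟨E.ord.symm x, ?_, by simp⟩
      simpa [S] using hx
  have hmem : ∀ v ∈ S, σ v ∈ S := by
    intro v hv
    simp only [S, Finset.mem_filter, Finset.mem_univ, true_and] at hv ⊢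
    have ne1 : σ v ≠ a := by
      intro h
      have : v = b := by rw [← inv v, h, hσa]
      subst this
      exact lt_irrefl _ hv.2
    have ne2 : σ v ≠ b := by
      intro h
      have : v = a := by rw [← inv v, h, hσb]
      subst this
      exact lt_irrefl _ hv.1
    have o1 : E.ord (σ v) ≠ E.ord a := fun h => ne1 (E.ord.injective h)
    have o2 : E.ord (σ v) ≠ E.ord b := fun h => ne2 (E.ord.injective h)
    constructor
    · by_contra hcon
      have h3 : E.ord (σ v) < E.ord a := lt_of_le_of_ne (not_lt.1 hcon) o1
      exact E.noncross ⟨s(v, σ v), hσ v⟩ ⟨s(a, b), hab⟩ (hσp v) (σ v) v a b Sym2.eq_swap rfl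
        h3 hv.1 hv.2
    · by_contra hcon
      have h3 : E.ord b < E.ord (σ v) := lt_of_le_of_ne (not_lt.1 hcon) o2.symm
      exact E.noncross ⟨s(a, b), hab⟩ ⟨s(v, σ v), hσ v⟩ (hσp v).symm a b v (σ v) rfl rfl
        hv.1 hv.2 h3
  have hsum : ∑ x ∈ S, (1 : ZMod 2) = 0 :=
    Finset.sum_involution (fun v _ => σ v) (fun _ _ => by decide)
      (fun v _ _ => (hσ v).ne') (fun v hv => hmem v hv) (fun v _ => inv v)
  have heven : Even S.card := by
    rw [Finset.sum_const, nsmul_eq_mul, mul_one] at hsum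
    exact (ZMod.natCast_eq_zero_iff_even).1 hsum
  rw [hS] at heven
  have hlt' : (E.ord a).val < (E.ord b).val := hlt
  rw [Nat.even_iff] at heven
  omega

theorem maxDegP {V : Type*} [Fintype V] [Nonempty V] (G : SimpleGraph V) [DecidableRel G.Adj]
    {lf : G.LocallyFinite} {d : ℕ} (h : G.IsRegularOfDegree d) : G.maxDegree = d := by
  apply SimpleGraph.IsRegularOfDegree.maxDegree_eq
  intro v
  rw [← h v]
  congr!

/-- For `n ≥ 2`, `m ≥ 1`, `mbt (K_{2n} □ C_{2m+1}) = 2n + 2`, one more than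
the maximum degree `2n + 1`. -/
theorem stmt_9 (n m : ℕ) (hn : 2 ≤ n) (hm : 1 ≤ m) :
    mbt ((⊤ : SimpleGraph (Fin (2 * n))) □ cycleGraph (2 * m + 1)) = 2 * n + 2 ∧
    ((⊤ : SimpleGraph (Fin (2 * n))) □ cycleGraph (2 * m + 1)).maxDegree = 2 * n + 1 := by
  have hreg := regularP n m hn hm
  refine ⟨?_, ?_⟩
  · apply le_antisymm
    · exact Nat.sInf_le (embed_upper n m hn hm)
    · have hne : {k | Nonempty (MatchingBookEmbedding
          ((⊤ : SimpleGraph (Fin (2 * n))) □ cycleGraph (2 * m + 1)) k)}.Nonempty :=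
        ⟨_, embed_upper n m hn hm⟩
      obtain ⟨E⟩ := Nat.sInf_mem hne
      change 2 * n + 2 ≤ sInf {k | Nonempty (MatchingBookEmbedding
          ((⊤ : SimpleGraph (Fin (2 * n))) □ cycleGraph (2 * m + 1)) k)}
      generalize sInf {k | Nonempty (MatchingBookEmbedding
          ((⊤ : SimpleGraph (Fin (2 * n))) □ cycleGraph (2 * m + 1)) k)} = k at E ⊢
      by_contra hk
      have hpar := parityP _ k E (fun v => by rw [(degP _ v _ _).trans (hreg v)]; omega)
      let x (i : ℕ) (hi : i < 2*n) : Fin (2*n) × Fin (2*m+1) := (⟨i, hi⟩, 0)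
      have adj : ∀ i j (hi : i < 2*n) (hj : j < 2*n), i ≠ j →
          ((⊤ : SimpleGraph (Fin (2 * n))) □ cycleGraph (2 * m + 1)).Adj (x i hi) (x j hj) := by
        intro i j hi hj hij
        rw [boxProd_adj]
        left
        refine ⟨?_, rfl⟩
        rw [SimpleGraph.top_adj]
        intro h
        exact hij (congrArg Fin.val h)
      have h1 := hpar _ _ (adj 0 1 (by omega) (by omega) (by omega))
      have h2 := hpar _ _ (adj 1 2 (by omega) (by omega) (by omega))
      have h3 := hpar _ _ (adj 0 2 (by omega) (by omega) (by omega))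
      omega
  · have : Nonempty (Fin (2*n) × Fin (2*m+1)) := ⟨(⟨0, by omega⟩, 0)⟩
    exact maxDegP _ hreg
end
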